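/- Let φ : ℝ² → ℂ be continuous and let A₀ : ℝ² → ℝ be a twice continuously differentiable solution of ΔA₀ = |φ|² A₀ on ℝ² with ∫_{ℝ²} |∇A₀|² dx < ∞. Then for every M > 0 and every R > 1, ∫_{{|A₀| < M} ∩ B_R} (|φ|² A₀² + |∇A₀|²) dx ≤ M (2π ∫_{ℝ²} |∇A₀|² dx)^{1/2} / (log R)^{1/2}, where B_R is the disk of radius R centered at the origin. -/

import Mathlib

/-!
The key truncation/logarithmic-cutoff estimate in the proof of the
Julia–Zee theorem (inequality (2.20) of Spruck–Yang).
-/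

open MeasureTheory

noncomputable section

/-- The plane ℝ². -/
abbrev Plane : Type := EuclideanSpace ℝ (Fin 2)

/-- Partial derivative in the `i`-th coordinate direction. -/
def pd (i : Fin 2) (f : Plane → ℝ) (x : Plane) : ℝ :=
  fderiv ℝ f x (EuclideanSpace.single i 1)

/-- The Laplacian on ℝ²: Δf = ∂₁²f + ∂₂²f. -/
def lap (f : Plane → ℝ) (x : Plane) : ℝ :=
  pd 0 (pd 0 f) x + pd 1 (pd 1 f) x

open Filter Topology Real

lemma gradient_apply_eq_pd (f : Plane → ℝ) (x : Plane) (i : Fin 2) :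
    gradient f x i = pd i f x := by
  have h := inner_gradient_left (𝕜 := ℝ) (f := f) (x := x) (y := EuclideanSpace.single i 1)
  rw [EuclideanSpace.inner_single_right] at h
  simpa [pd, -inner_gradient_left] using h

lemma norm_gradient_sq (f : Plane → ℝ) (x : Plane) :
    ‖gradient f x‖ ^ 2 = pd 0 f x ^ 2 + pd 1 f x ^ 2 := by
  simp [EuclideanSpace.real_norm_sq_eq, gradient_apply_eq_pd]

lemma continuous_pd {f : Plane → ℝ} (hf : ContDiff ℝ 1 f) (i : Fin 2) : Continuous (pd i f) :=
  (hf.continuous_fderiv one_ne_zero).clm_apply continuous_const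

lemma contDiff_pd {f : Plane → ℝ} (hf : ContDiff ℝ 2 f) (i : Fin 2) : ContDiff ℝ 1 (pd i f) :=
  (hf.fderiv_right (m := 1) (by norm_num)).clm_apply contDiff_const

lemma HasCompactSupport.pd {f : Plane → ℝ} (hf : HasCompactSupport f) (i : Fin 2) :
    HasCompactSupport (pd i f) :=
  hf.fderiv_apply ℝ _

lemma integral_mul_pd {w g : Plane → ℝ} (hw : ContDiff ℝ 1 w) (hc : HasCompactSupport w)
    (hg : ContDiff ℝ 1 g) (i : Fin 2) :
    ∫ x, w x * pd i g x = -∫ x, pd i w x * g x :=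
  integral_mul_fderiv_eq_neg_fderiv_mul_of_integrable
    (((continuous_pd hw i).mul hg.continuous).integrable_of_hasCompactSupport (hc.pd i).mul_right)
    ((hw.continuous.mul (continuous_pd hg i)).integrable_of_hasCompactSupport hc.mul_right)
    ((hw.continuous.mul hg.continuous).integrable_of_hasCompactSupport hc.mul_right)
    (fun x _ => hw.differentiable one_ne_zero x) (fun x _ => hg.differentiable one_ne_zero x)

lemma integral_mul_lap {w f : Plane → ℝ} (hw : ContDiff ℝ 1 w) (hc : HasCompactSupport w)
    (hf : ContDiff ℝ 2 f) :
    ∫ x, w x * lap f x = -∫ x, (pd 0 w x * pd 0 f x + pd 1 w x * pd 1 f x) := by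
  have h1 (i : Fin 2) : Integrable (fun x => w x * pd i (pd i f) x) :=
    (hw.continuous.mul (continuous_pd (contDiff_pd hf i) i)).integrable_of_hasCompactSupport
      hc.mul_right
  have h2 (i : Fin 2) : Integrable (fun x => pd i w x * pd i f x) :=
    ((continuous_pd hw i).mul (contDiff_pd hf i).continuous).integrable_of_hasCompactSupport
      (hc.pd i).mul_right
  simp only [lap, mul_add]
  rw [integral_add (h1 0) (h1 1), integral_add (h2 0) (h2 1),
    integral_mul_pd hw hc (contDiff_pd hf 0), integral_mul_pd hw hc (contDiff_pd hf 1)]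
  ring

lemma pd_mul_arctan {η f : Plane → ℝ} (hη : Differentiable ℝ η) (hf : Differentiable ℝ f)
    (i : Fin 2) (x : Plane) :
    pd i (fun y => η y * arctan (f y)) x
      = arctan (f x) * pd i η x + η x * (pd i f x / (1 + f x ^ 2)) := by
  have h := (hη x).hasFDerivAt.mul (hf x).hasFDerivAt.arctan
  have h' : fderiv ℝ (fun y => η y * arctan (f y)) x = _ := h.fderiv
  rw [pd, h']
  simp [pd]
  ring

/-- The density obtained by testing `Δf = ‖φ‖² f` against `arctan f`. -/
def arctanEnergy (φ : Plane → ℂ) (f : Plane → ℝ) (x : Plane) : ℝ :=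
  ‖φ x‖ ^ 2 * (f x * arctan (f x)) + ‖gradient f x‖ ^ 2 / (1 + f x ^ 2)

lemma mul_arctan_nonneg (t : ℝ) : 0 ≤ t * arctan t := by
  rcases le_total 0 t with h | h
  · exact mul_nonneg h (arctan_nonneg.2 h)
  · exact mul_nonneg_of_nonpos_of_nonpos h (by simpa using arctan_mono h)

lemma arctanEnergy_nonneg (φ : Plane → ℂ) (f : Plane → ℝ) (x : Plane) :
    0 ≤ arctanEnergy φ f x :=
  add_nonneg (mul_nonneg (sq_nonneg _) (mul_arctan_nonneg _)) (by positivity)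

lemma continuous_arctanEnergy {φ : Plane → ℂ} {f : Plane → ℝ} (hφ : Continuous φ)
    (hf : ContDiff ℝ 2 f) : Continuous (arctanEnergy φ f) := by
  have h0 := (contDiff_pd hf 0).continuous
  have h1 := (contDiff_pd hf 1).continuous
  have hc := hf.continuous
  have ha := continuous_arctan.comp hc
  unfold arctanEnergy
  simp only [norm_gradient_sq]
  refine ((hφ.norm.pow 2).mul (hc.mul ha)).add
    (((h0.pow 2).add (h1.pow 2)).div (continuous_const.add (hc.pow 2)) fun x => by positivity)

lemma integral_mul_arctanEnergy {φ : Plane → ℂ} {f η : Plane → ℝ} (hφ : Continuous φ)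
    (hf : ContDiff ℝ 2 f) (heq : ∀ x, lap f x = ‖φ x‖ ^ 2 * f x)
    (hη : ContDiff ℝ 1 η) (hc : HasCompactSupport η) :
    ∫ x, η x * arctanEnergy φ f x
      = ∫ x, -(arctan (f x) * (pd 0 η x * pd 0 f x + pd 1 η x * pd 1 f x)) := by
  have hf1 : ContDiff ℝ 1 f := hf.of_le (by norm_num)
  have hw : ContDiff ℝ 1 (fun x => η x * arctan (f x)) := hη.mul hf1.arctan
  have hwc : HasCompactSupport (fun x => η x * arctan (f x)) := hc.mul_right
  have key := integral_mul_lap hw hwc hf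
  have hdη := hη.differentiable one_ne_zero
  have hdf := hf1.differentiable one_ne_zero
  have iL : Integrable (fun x => η x * arctan (f x) * lap f x) := by
    simp only [heq]
    exact (hw.continuous.mul ((hφ.norm.pow 2).mul hf.continuous)).integrable_of_hasCompactSupport
      hwc.mul_right
  have iR : Integrable (fun x => pd 0 (fun y => η y * arctan (f y)) x * pd 0 f x
      + pd 1 (fun y => η y * arctan (f y)) x * pd 1 f x) :=
    (((continuous_pd hw 0).mul (continuous_pd hf1 0)).integrable_of_hasCompactSupport
      (hwc.pd 0).mul_right).add
    (((continuous_pd hw 1).mul (continuous_pd hf1 1)).integrable_of_hasCompactSupport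
      (hwc.pd 1).mul_right)
  have iE : Integrable (fun x => η x * arctanEnergy φ f x) :=
    (hη.continuous.mul (continuous_arctanEnergy hφ hf)).integrable_of_hasCompactSupport
      hc.mul_right
  rw [eq_neg_iff_add_eq_zero, ← integral_add iL iR] at key
  have hsum : ∀ x, -(arctan (f x) * (pd 0 η x * pd 0 f x + pd 1 η x * pd 1 f x))
      = η x * arctanEnergy φ f x - (η x * arctan (f x) * lap f x
        + (pd 0 (fun y => η y * arctan (f y)) x * pd 0 f x
          + pd 1 (fun y => η y * arctan (f y)) x * pd 1 f x)) := by
    intro x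
    rw [pd_mul_arctan hdη hdf, pd_mul_arctan hdη hdf, heq, arctanEnergy, norm_gradient_sq]
    ring
  simp only [hsum]
  refine Eq.trans ?_ (integral_sub iE (iL.add iR)).symm
  simp only [Pi.add_apply]
  rw [key, sub_zero]

/-- The doubly logarithmic exhaustion of the plane. -/
def loglog (x : Plane) : ℝ := log (1 + log (1 + ‖x‖ ^ 2))

lemma log_one_add_sq_nonneg (r : ℝ) : 0 ≤ log (1 + r ^ 2) :=
  log_nonneg (by nlinarith [sq_nonneg r])

lemma loglog_nonneg (x : Plane) : 0 ≤ loglog x :=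
  log_nonneg (by linarith [log_one_add_sq_nonneg ‖x‖])

lemma contDiff_loglog : ContDiff ℝ 1 loglog := by
  have h : ContDiff ℝ 1 (fun x : Plane => 1 + ‖x‖ ^ 2) := contDiff_const.add (contDiff_norm_sq ℝ)
  refine (contDiff_const.add (h.log fun x => by positivity)).log fun x => ?_
  linarith [log_one_add_sq_nonneg ‖x‖]

lemma tendsto_loglog : Tendsto loglog (cocompact Plane) atTop := by
  have h : Tendsto (fun x : Plane => ‖x‖ ^ 2) (cocompact Plane) atTop :=
    (tendsto_pow_atTop two_ne_zero).comp (tendsto_norm_cocompact_atTop (E := Plane))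
  exact tendsto_log_atTop.comp (tendsto_atTop_add_const_left _ _
    (tendsto_log_atTop.comp (tendsto_atTop_add_const_left _ _ h)))

/-- A radial majorant of the squared partial derivatives of `loglog`. -/
def loglogWeight (r : ℝ) : ℝ := 4 / ((1 + r ^ 2) * (1 + log (1 + r ^ 2)) ^ 2)

lemma pd_loglog_sq_le (i : Fin 2) (x : Plane) : pd i loglog x ^ 2 ≤ loglogWeight ‖x‖ := by
  have hL := log_one_add_sq_nonneg ‖x‖
  have h1 : HasFDerivAt (fun y : Plane => 1 + ‖y‖ ^ 2) (2 • innerSL ℝ x) x :=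
    ((hasStrictFDerivAt_norm_sq x).hasFDerivAt).const_add 1
  have h2 := ((h1.log (by positivity)).const_add 1).log (by linarith)
  have h3 : fderiv ℝ loglog x = _ := h2.fderiv
  have h4 : pd i loglog x = (1 + log (1 + ‖x‖ ^ 2))⁻¹ * ((1 + ‖x‖ ^ 2)⁻¹ * (2 * x i)) := by
    rw [pd, h3]
    simp [EuclideanSpace.inner_single_right]
  have hx : x i ^ 2 ≤ ‖x‖ ^ 2 := by
    rw [EuclideanSpace.real_norm_sq_eq]
    exact Finset.single_le_sum (f := fun j => x j ^ 2) (fun j _ => sq_nonneg _) (Finset.mem_univ i)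
  have hpos : 0 < 1 + log (1 + ‖x‖ ^ 2) := by linarith
  have hpos' : 0 < 1 + ‖x‖ ^ 2 := by positivity
  rw [h4, loglogWeight]
  generalize 1 + log (1 + ‖x‖ ^ 2) = L at *
  have : (L⁻¹ * ((1 + ‖x‖ ^ 2)⁻¹ * (2 * x i))) ^ 2
      = 4 / ((1 + ‖x‖ ^ 2) * L ^ 2) * (x i ^ 2 / (1 + ‖x‖ ^ 2)) := by
    field_simp
    ring
  rw [this]
  refine mul_le_of_le_one_right (by positivity) ?_
  rw [div_le_one hpos']
  linarith

lemma integrable_loglogWeight : Integrable (fun x : Plane => loglogWeight ‖x‖) := by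
  rw [integrable_fun_norm_addHaar volume (f := loglogWeight)]
  have hd (r : ℝ) : HasDerivAt (fun s : ℝ => -2 / (1 + log (1 + s ^ 2)))
      (r ^ (Module.finrank ℝ Plane - 1) • loglogWeight r) r := by
    have hL := log_one_add_sq_nonneg r
    have h1 : HasDerivAt (fun s : ℝ => 1 + s ^ 2) (2 * r) r := by
      simpa using (hasDerivAt_pow 2 r).const_add 1
    have hpos' : 0 < 1 + r ^ 2 := by positivity
    have hpos : 0 < 1 + log (1 + r ^ 2) := by linarith
    have h2 := (hasDerivAt_const r (-2 : ℝ)).div ((h1.log hpos'.ne').const_add 1) hpos.ne'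
    refine h2.congr_deriv ?_
    have : Module.finrank ℝ Plane = 2 := by simp
    rw [this, loglogWeight]
    simp only [smul_eq_mul]
    generalize 1 + log (1 + r ^ 2) = L at *
    field_simp
    ring
  refine integrableOn_Ioi_deriv_of_nonneg' (l := 0) (fun r _ => hd r) (fun r hr => ?_) ?_
  · have : (0 : ℝ) < r := hr
    have hL := log_one_add_sq_nonneg r
    rw [loglogWeight]
    positivity
  · exact Tendsto.const_div_atTop (tendsto_atTop_add_const_left _ _ (tendsto_log_atTop.comp
      (tendsto_atTop_add_const_left _ _ (tendsto_pow_atTop two_ne_zero)))) _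

lemma hasDerivAt_max_zero_sq (t : ℝ) :
    HasDerivAt (fun s : ℝ => max 0 s ^ 2) (2 * max 0 t) t := by
  rcases lt_trichotomy t 0 with h | rfl | h
  · rw [max_eq_left h.le, mul_zero]
    refine (hasDerivAt_const t (0 : ℝ)).congr_of_eventuallyEq ?_
    filter_upwards [eventually_lt_nhds h] with s hs
    simp [max_eq_left hs.le]
  · have h2 : HasDerivAt (fun s : ℝ => s ^ 2) 0 0 := by simpa using hasDerivAt_pow 2 (0 : ℝ)
    rw [hasDerivAt_iff_isLittleO] at h2 ⊢
    refine Asymptotics.IsBigO.trans_isLittleO (Asymptotics.IsBigO.of_bound 1 ?_) h2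
    filter_upwards with s
    rcases le_total 0 s with hs | hs
    · simp [max_eq_right hs]
    · simp [max_eq_left hs, sq_nonneg]
  · rw [max_eq_right h.le]
    have h2 : HasDerivAt (fun s : ℝ => s ^ 2) (2 * t) t := by simpa using hasDerivAt_pow 2 t
    refine h2.congr_of_eventuallyEq ?_
    filter_upwards [eventually_gt_nhds h] with s hs
    simp [max_eq_right hs.le]

lemma contDiff_max_zero_sq : ContDiff ℝ 1 (fun s : ℝ => max 0 s ^ 2) := by
  rw [contDiff_one_iff_deriv]
  refine ⟨fun t => (hasDerivAt_max_zero_sq t).differentiableAt, ?_⟩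
  have : deriv (fun s : ℝ => max 0 s ^ 2) = fun t => 2 * max 0 t :=
    funext fun t => (hasDerivAt_max_zero_sq t).deriv
  rw [this]
  fun_prop

/-- A compactly supported `C¹` cutoff whose gradient is of size `c`. -/
def loglogCutoff (c : ℝ) (x : Plane) : ℝ := max 0 (1 - c * loglog x) ^ 2

lemma contDiff_loglogCutoff (c : ℝ) : ContDiff ℝ 1 (loglogCutoff c) :=
  contDiff_max_zero_sq.comp (contDiff_const.sub (contDiff_const.mul contDiff_loglog))

lemma hasCompactSupport_loglogCutoff {c : ℝ} (hc : 0 < c) :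
    HasCompactSupport (loglogCutoff c) := by
  rw [hasCompactSupport_iff_eventuallyEq, coclosedCompact_eq_cocompact]
  filter_upwards [tendsto_loglog.eventually_ge_atTop (1 / c)] with x hx
  have : 1 ≤ c * loglog x := by
    rwa [div_le_iff₀ hc, mul_comm] at hx
  simp [loglogCutoff, max_eq_left (sub_nonpos.2 this)]

lemma abs_pd_loglogCutoff_le {c : ℝ} (hc : 0 < c) (i : Fin 2) (x : Plane) :
    |pd i (loglogCutoff c) x| ≤ 2 * c * |pd i loglog x| := by
  have h1 := (contDiff_loglog.differentiable one_ne_zero x).hasFDerivAt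
  have h2 := (hasDerivAt_max_zero_sq (1 - c * loglog x)).comp_hasFDerivAt x
    ((h1.const_mul c).const_sub 1)
  have h3 : fderiv ℝ (loglogCutoff c) x = _ := h2.fderiv
  have h4 : pd i (loglogCutoff c) x
      = -(max 0 (1 - c * loglog x) * (2 * c * pd i loglog x)) := by
    rw [pd, h3]
    simp [pd]
    ring
  have h5 : max 0 (1 - c * loglog x) ≤ 1 :=
    max_le zero_le_one (by nlinarith [mul_nonneg hc.le (loglog_nonneg x)])
  rw [h4, abs_neg, abs_mul, abs_mul (2 * c), abs_of_nonneg (le_max_left _ _),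
    abs_of_pos (by positivity : 0 < 2 * c)]
  exact mul_le_of_le_one_left (by positivity) h5

lemma integral_loglogCutoff_mul_arctanEnergy_le {φ : Plane → ℂ} {f : Plane → ℝ}
    (hφ : Continuous φ) (hf : ContDiff ℝ 2 f) (heq : ∀ x, lap f x = ‖φ x‖ ^ 2 * f x)
    (hfin : Integrable (fun x => ‖gradient f x‖ ^ 2)) {c : ℝ} (hc : 0 < c) :
    ∫ x, loglogCutoff c x * arctanEnergy φ f x
      ≤ c * ∫ x, (4 * loglogWeight ‖x‖ + 2 * ‖gradient f x‖ ^ 2) := by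
  have hη := contDiff_loglogCutoff c
  have hηc := hasCompactSupport_loglogCutoff hc
  have hf1 : ContDiff ℝ 1 f := hf.of_le (by norm_num)
  rw [integral_mul_arctanEnergy hφ hf heq hη hηc, ← integral_const_mul]
  refine integral_mono ?_ ?_ fun x => ?_
  · refine Continuous.integrable_of_hasCompactSupport ?_ ?_
    · exact ((continuous_arctan.comp hf.continuous).mul
        (((continuous_pd hη 0).mul (continuous_pd hf1 0)).add
          ((continuous_pd hη 1).mul (continuous_pd hf1 1)))).neg
    · exact (HasCompactSupport.mul_left
        ((hηc.pd 0).mul_right.add (hηc.pd 1).mul_right)).neg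
  · exact ((integrable_loglogWeight.const_mul 4).add (hfin.const_mul 2)).const_mul c
  · have ha : |arctan (f x)| ≤ 2 := by
      rw [abs_le]
      constructor <;>
        linarith [neg_pi_div_two_lt_arctan (f x), arctan_lt_pi_div_two (f x), pi_le_four]
    have hterm (i : Fin 2) : |pd i (loglogCutoff c) x * pd i f x|
        ≤ c * (loglogWeight ‖x‖ + pd i f x ^ 2) := by
      rw [abs_mul]
      calc _ ≤ 2 * c * |pd i loglog x| * |pd i f x| := by
            gcongr
            exact abs_pd_loglogCutoff_le hc i x
        _ = c * (2 * |pd i loglog x| * |pd i f x|) := by ring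
        _ ≤ c * (|pd i loglog x| ^ 2 + |pd i f x| ^ 2) := by
            gcongr
            exact two_mul_le_add_sq _ _
        _ ≤ _ := by
            rw [sq_abs, sq_abs]
            gcongr
            exact pd_loglog_sq_le i x
    calc -(arctan (f x) * (pd 0 (loglogCutoff c) x * pd 0 f x
            + pd 1 (loglogCutoff c) x * pd 1 f x))
        ≤ |arctan (f x)| * |pd 0 (loglogCutoff c) x * pd 0 f x
            + pd 1 (loglogCutoff c) x * pd 1 f x| := by
          rw [← abs_mul]
          exact neg_le_abs _
      _ ≤ 2 * (c * (loglogWeight ‖x‖ + pd 0 f x ^ 2) + c * (loglogWeight ‖x‖ + pd 1 f x ^ 2)) := by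
          gcongr
          exact (abs_add_le _ _).trans (add_le_add (hterm 0) (hterm 1))
      _ = c * (4 * loglogWeight ‖x‖ + 2 * ‖gradient f x‖ ^ 2) := by
          rw [norm_gradient_sq]
          ring

lemma arctanEnergy_eq_zero {φ : Plane → ℂ} {f : Plane → ℝ}
    (hφ : Continuous φ) (hf : ContDiff ℝ 2 f) (heq : ∀ x, lap f x = ‖φ x‖ ^ 2 * f x)
    (hfin : Integrable (fun x => ‖gradient f x‖ ^ 2)) (x : Plane) :
    arctanEnergy φ f x = 0 := by
  by_contra hx
  set b : ℝ := 1 / (1 + loglog x) with hb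
  have hl := loglog_nonneg x
  have hb0 : 0 < b := by positivity
  have hηx : loglogCutoff b x ≠ 0 := by
    have : 0 < 1 - b * loglog x := by
      rw [hb]
      field_simp
      linarith
    simp [loglogCutoff, max_eq_right this.le, this.ne']
  have hint (c : ℝ) (hc : 0 < c) : Integrable fun y => loglogCutoff c y * arctanEnergy φ f y :=
    ((contDiff_loglogCutoff c).continuous.mul
      (continuous_arctanEnergy hφ hf)).integrable_of_hasCompactSupport
      (hasCompactSupport_loglogCutoff hc).mul_right
  have hpos : 0 < ∫ y, loglogCutoff b y * arctanEnergy φ f y :=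
    Continuous.integral_pos_of_hasCompactSupport_nonneg_nonzero
      ((contDiff_loglogCutoff b).continuous.mul (continuous_arctanEnergy hφ hf))
      (hasCompactSupport_loglogCutoff hb0).mul_right
      (fun y => mul_nonneg (sq_nonneg _) (arctanEnergy_nonneg φ f y)) (mul_ne_zero hηx hx)
  have hle : ∀ᶠ c in 𝓝[>] (0 : ℝ), ∫ y, loglogCutoff b y * arctanEnergy φ f y
      ≤ c * ∫ y, (4 * loglogWeight ‖y‖ + 2 * ‖gradient f y‖ ^ 2) := by
    filter_upwards [Ioo_mem_nhdsGT hb0] with c hc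
    refine le_trans (integral_mono (hint b hb0) (hint c hc.1) fun y => ?_)
      (integral_loglogCutoff_mul_arctanEnergy_le hφ hf heq hfin hc.1)
    refine mul_le_mul_of_nonneg_right ?_ (arctanEnergy_nonneg φ f y)
    have := mul_le_mul_of_nonneg_right hc.2.le (loglog_nonneg y)
    unfold loglogCutoff
    gcongr
  have hlim : Tendsto (fun c : ℝ => c * ∫ y, (4 * loglogWeight ‖y‖ + 2 * ‖gradient f y‖ ^ 2))
      (𝓝[>] 0) (𝓝 0) := by
    have : Tendsto (fun c : ℝ => c * ∫ y, (4 * loglogWeight ‖y‖ + 2 * ‖gradient f y‖ ^ 2))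
      (𝓝 0) (𝓝 (0 * _)) := tendsto_id.mul_const _
    rw [zero_mul] at this
    exact this.mono_left nhdsWithin_le_nhds
  exact absurd (ge_of_tendsto hlim hle) hpos.not_ge

theorem julia_zee_cutoff_estimate (φ : Plane → ℂ) (A₀ : Plane → ℝ)
    (hφ : Continuous φ) (hA₀ : ContDiff ℝ 2 A₀)
    (heq : ∀ x, lap A₀ x = ‖φ x‖ ^ 2 * A₀ x)
    (hfin : Integrable (fun x => ‖gradient A₀ x‖ ^ 2))
    (M R : ℝ) (hM : 0 < M) (hR : 1 < R) :
    (∫ x in {x : Plane | |A₀ x| < M} ∩ Metric.ball (0 : Plane) R,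
        (‖φ x‖ ^ 2 * (A₀ x) ^ 2 + ‖gradient A₀ x‖ ^ 2))
      ≤ M * Real.sqrt (2 * Real.pi * ∫ x, ‖gradient A₀ x‖ ^ 2) /
          Real.sqrt (Real.log R) := by
  have hzero (x : Plane) : ‖φ x‖ ^ 2 * (A₀ x) ^ 2 + ‖gradient A₀ x‖ ^ 2 = 0 := by
    have h := arctanEnergy_eq_zero hφ hA₀ heq hfin x
    have h1 : 0 ≤ ‖φ x‖ ^ 2 * (A₀ x * arctan (A₀ x)) :=
      mul_nonneg (sq_nonneg _) (mul_arctan_nonneg _)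
    have h2 : 0 ≤ ‖gradient A₀ x‖ ^ 2 / (1 + A₀ x ^ 2) := by positivity
    obtain ⟨h3, h4⟩ := (add_eq_zero_iff_of_nonneg h1 h2).1 h
    have h5 : ‖gradient A₀ x‖ ^ 2 = 0 :=
      (div_eq_zero_iff.1 h4).resolve_right (by positivity)
    have h6 : φ x = 0 ∨ A₀ x = 0 := by simpa [arctan_eq_zero_iff] using h3
    rw [h5]
    rcases h6 with h6 | h6 <;> simp [h6]
  simp only [hzero, integral_zero]
  positivity

end
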